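/- arXiv:1911.05535 — 7 statements merged into one kernel-verified Lean document; each statement's English description precedes it below -/
import Mathlib

section
/- Fix an integer K ≥ 1. Define real numbers d_K, d_{K-1}, …, d_1 recursively by d_K = 1 and, for 1 ≤ p ≤ K−1, d_p = ((K−p+1)·binom(K,p)) / (binom(K,p) + p·binom(K,p+1)/d_{p+1}). Then every d_p is strictly positive (so the recursion is well defined) and d_1 = K / (∑_{p=1}^{K} 1/p). -/
/-- The closed form of every term of the MAT recursion. -/
theorem mat_dof_general_closed_form (K : ℕ) (d : ℕ → ℝ)
    (hdK : d K = 1)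
    (hrec : ∀ p, 1 ≤ p → p ≤ K - 1 →
      d p = (((K : ℝ) - p + 1) * (K.choose p : ℝ)) /
        ((K.choose p : ℝ) + (p : ℝ) * (K.choose (p + 1) : ℝ) / d (p + 1)))
    {p : ℕ} (hp : 1 ≤ p) (hpK : p ≤ K) :
    d p = ((K : ℝ) - p + 1) / (p * ∑ i ∈ Finset.Icc p K, (1 : ℝ) / i) := by
  induction hpK using Nat.decreasingInduction with
  | self =>
    have hK : (K : ℝ) ≠ 0 := by positivity
    simp [hdK, hK]
  | of_succ p hlt ih =>
    have hp0 : (0 : ℝ) < p := by exact_mod_cast hp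
    have hKp : (0 : ℝ) < (K : ℝ) - p := sub_pos.mpr (by exact_mod_cast hlt)
    have hC : (0 : ℝ) < K.choose p := by exact_mod_cast Nat.choose_pos hlt.le
    have hsucc : (K.choose (p + 1) : ℝ) = K.choose p * ((K : ℝ) - p) / (p + 1) := by
      rw [eq_div_iff (by positivity), ← Nat.cast_sub hlt.le]
      exact_mod_cast Nat.choose_succ_right_eq K p
    have hS : 0 < ∑ i ∈ Finset.Icc (p + 1) K, (1 : ℝ) / i := by
      refine Finset.sum_pos (fun i hi ↦ ?_) ⟨K, Finset.mem_Icc.mpr ⟨hlt, le_rfl⟩⟩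
      have : 0 < i := by have := (Finset.mem_Icc.mp hi).1; omega
      positivity
    rw [hrec p hp (by omega), ih (by omega), hsucc,
      ← Finset.add_sum_Ioc_eq_sum_Icc hlt.le, ← Finset.Icc_add_one_left_eq_Ioc]
    set S := ∑ i ∈ Finset.Icc (p + 1) K, (1 : ℝ) / i
    push_cast
    rw [show (K : ℝ) - (p + 1) + 1 = K - p by ring]
    have hden : (K.choose p : ℝ) + p * (K.choose p * ((K : ℝ) - p) / (p + 1)) /
        (((K : ℝ) - p) / ((p + 1) * S)) = K.choose p * (p * (1 / p + S)) := by
      field_simp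
    rw [hden, mul_comm ((K : ℝ) - p + 1), mul_div_mul_left _ _ hC.ne']


/-- MAT recursion for the K-user MISO BC: with terminal value `d K = 1` and the
recursive relation, every `d p` (1 ≤ p ≤ K) is strictly positive and
`d 1 = K / H_K` where `H_K` is the K-th harmonic number. -/
theorem mat_dof_closed_form (K : ℕ) (hK : 1 ≤ K) (d : ℕ → ℝ)
    (hdK : d K = 1)
    (hrec : ∀ p, 1 ≤ p → p ≤ K - 1 →
      d p = (((K : ℝ) - p + 1) * (K.choose p : ℝ)) /
        ((K.choose p : ℝ) + (p : ℝ) * (K.choose (p + 1) : ℝ) / d (p + 1))) :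
    (∀ p, 1 ≤ p → p ≤ K → 0 < d p) ∧
    d 1 = (K : ℝ) / ∑ p ∈ Finset.Icc 1 K, (1 : ℝ) / p := by
  have hform := fun {p : ℕ} ↦ mat_dof_general_closed_form K d hdK hrec (p := p)
  refine ⟨fun p hp hpK ↦ ?_, by simpa using hform le_rfl hK⟩
  rw [hform hp hpK]
  have hp0 : (0 : ℝ) < p := by exact_mod_cast hp
  have hKp : (0 : ℝ) ≤ (K : ℝ) - p := sub_nonneg.mpr (by exact_mod_cast hpK)
  have hS : 0 < ∑ i ∈ Finset.Icc p K, (1 : ℝ) / i := by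
    refine Finset.sum_pos (fun i hi ↦ ?_) ⟨K, Finset.mem_Icc.mpr ⟨hpK, le_rfl⟩⟩
    have : 0 < i := hp.trans (Finset.mem_Icc.mp hi).1
    positivity
  positivity
end

section
/- For every integer K ≥ 3, the quantity s_K = (1/(K−1)) · ∑_{l=2}^{K−1} (K−l)/(l²−1) satisfies 0 ≤ s_K < 3/4; consequently d_2^{HC} = (1 − s_K)^{−1} is well defined and satisfies 1 ≤ d_2^{HC} < 4. -/
theorem sum_Icc_one_div_sq_sub_one {n : ℕ} (hn : 1 ≤ n) :
    ∑ l ∈ Finset.Icc 2 n, 1 / ((l : ℝ) ^ 2 - 1) =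
      3 / 4 - (1 / (n : ℝ) + 1 / ((n : ℝ) + 1)) / 2 := by
  induction n, hn using Nat.le_induction with
  | base => norm_num
  | succ n hn ih =>
    have hpos : (0 : ℝ) < n := by exact_mod_cast hn
    have hfactor : ((n : ℝ) + 1) ^ 2 - 1 = n * (n + 2) := by ring
    rw [Finset.sum_Icc_succ_top (by omega), ih]
    push_cast
    rw [hfactor]
    field_simp
    ring

/-- Boundedness of the HC order-2 DoF: for K ≥ 3, the quantity
`s_K = (1/(K−1)) ∑_{l=2}^{K−1} (K−l)/(l²−1)` satisfies `0 ≤ s_K < 3/4`, hence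
`d₂ = (1 − s_K)⁻¹` is well defined and `1 ≤ d₂ < 4`. -/
theorem hc_order2_dof_bounded (K : ℕ) (hK : 3 ≤ K) (s : ℝ)
    (hs : s = (1 / ((K : ℝ) - 1)) *
      ∑ l ∈ Finset.Icc 2 (K - 1), ((K : ℝ) - (l : ℝ)) / ((l : ℝ) ^ 2 - 1)) :
    (0 ≤ s ∧ s < 3 / 4) ∧ (1 ≤ (1 - s)⁻¹ ∧ (1 - s)⁻¹ < 4) := by
  have hK1 : (0 : ℝ) < K - 1 := by
    have : (3 : ℝ) ≤ K := by exact_mod_cast hK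
    linarith
  have hterm : ∀ l ∈ Finset.Icc 2 (K - 1),
      (2 : ℝ) ≤ l ∧ (l : ℝ) ≤ K ∧ (0 : ℝ) < (l : ℝ) ^ 2 - 1 := by
    intro l hl
    rw [Finset.mem_Icc] at hl
    have h2 : (2 : ℝ) ≤ l := by exact_mod_cast hl.1
    have hlK : (l : ℝ) ≤ K := by exact_mod_cast hl.2.trans (Nat.sub_le K 1)
    exact ⟨h2, hlK, by nlinarith⟩
  have hs_nonneg : 0 ≤ s := by
    rw [hs]
    refine mul_nonneg (by positivity) (Finset.sum_nonneg fun l hl => ?_)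
    obtain ⟨-, hlK, hpos⟩ := hterm l hl
    exact div_nonneg (sub_nonneg.mpr hlK) hpos.le
  have hs_lt : s < 3 / 4 := by
    have hle : s ≤ ∑ l ∈ Finset.Icc 2 (K - 1), 1 / ((l : ℝ) ^ 2 - 1) := by
      rw [hs, Finset.mul_sum]
      refine Finset.sum_le_sum fun l hl => ?_
      obtain ⟨h2, -, hpos⟩ := hterm l hl
      rw [← mul_div_assoc]
      gcongr
      rw [one_div_mul_eq_div, div_le_one hK1]
      linarith
    rw [sum_Icc_one_div_sq_sub_one (by omega)] at hle
    have hpos : (0 : ℝ) < ((K - 1 : ℕ) : ℝ) := by exact_mod_cast (by omega : 0 < K - 1)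
    have : (0 : ℝ) < (1 / ((K - 1 : ℕ) : ℝ) + 1 / (((K - 1 : ℕ) : ℝ) + 1)) / 2 := by positivity
    linarith
  refine ⟨⟨hs_nonneg, hs_lt⟩, (one_le_inv₀ (by linarith)).mpr (by linarith), ?_⟩
  rw [inv_lt_comm₀ (by linarith) (by norm_num)]
  linarith
end

section
/- Let L ≥ 2 and C ≥ 1 be integers and set K = L·C. For 2 ≤ p ≤ L−1 let ν_p = ∑_{r=2}^{min(p,C)} binom(C,r) · ∑_{(g_1,…,g_r) ∈ R_p^r} ∏_{j=1}^{r} binom(L,g_j) (an empty sum being 0). Define real numbers d_L, d_{L-1}, …, d_1 by d_L = 1, d_p = ((K−p+1)·binom(K,p)) / ((binom(K,p) + ν_p) + p·binom(K,p+1)/d_{p+1}) for 2 ≤ p ≤ L−1, and d_1 = (K·binom(K,1)) / (binom(K,1) + binom(K,2)/d_2). Then every d_p is strictly positive and d_1 = K / ( ∑_{p=1}^{L} 1/p + (C−1) + ∑_{p=2}^{L−1} ν_p / (p·binom(K,p)) ). -/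
theorem sum_Icc_eq_add_sum_Icc_succ (f : ℕ → ℝ) {a b : ℕ} (h : a ≤ b) :
    ∑ q ∈ Finset.Icc a b, f q = f a + ∑ q ∈ Finset.Icc (a + 1) b, f q := by
  rw [← Finset.insert_Icc_add_one_left_eq_Icc h, Finset.sum_insert (by simp)]

/-- Binomial coefficients satisfy `(p + 1) * binom(K, p + 1) = (K - p) * binom(K, p)`
over the reals, also when `p` exceeds `K`. -/
theorem cast_choose_succ_mul (K p : ℕ) :
    ((p : ℝ) + 1) * (K.choose (p + 1) : ℝ) = ((K : ℝ) - p) * (K.choose p : ℝ) := by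
  rcases le_or_gt p K with h | h
  · have := Nat.choose_succ_right_eq K p
    rw [← Nat.cast_sub h]
    exact_mod_cast (by linarith : (p + 1) * K.choose (p + 1) = (K - p) * K.choose p)
  · simp [Nat.choose_eq_zero_of_lt h, Nat.choose_eq_zero_of_lt (Nat.lt_succ_of_lt h)]

/-- One step of the recursion makes `(K - p + 1) / (p * d p)` telescope. -/
theorem dof_step {K p : ℕ} (hp : 1 ≤ p) (hpK : p < K) {n x y : ℝ} (hn : 0 ≤ n) (hy : 0 < y)
    (hx : x = (((K : ℝ) - p + 1) * (K.choose p : ℝ)) /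
      (((K.choose p : ℝ) + n) + (p : ℝ) * (K.choose (p + 1) : ℝ) / y)) :
    0 < x ∧ ((K : ℝ) - p + 1) / (p * x) =
      1 / p + n / (p * (K.choose p : ℝ)) + ((K : ℝ) - (p + 1 : ℕ) + 1) / ((p + 1 : ℕ) * y) := by
  have hp0 : (0 : ℝ) < p := by exact_mod_cast hp
  have hKp : (p : ℝ) < K := by exact_mod_cast hpK
  have hB : (0 : ℝ) < K.choose p := by exact_mod_cast Nat.choose_pos hpK.le
  have hA : (0 : ℝ) < (K : ℝ) - p + 1 := by linarith
  have hB' : (K.choose (p + 1) : ℝ) = ((K : ℝ) - p) * (K.choose p : ℝ) / (p + 1) := by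
    rw [← cast_choose_succ_mul]
    field_simp
  have hD : (0 : ℝ) < ((K.choose p : ℝ) + n) + (p : ℝ) * (K.choose (p + 1) : ℝ) / y := by
    positivity
  refine ⟨hx ▸ by positivity, ?_⟩
  have hxi : ((K : ℝ) - p + 1) / (p * x) =
      (((K.choose p : ℝ) + n) + (p : ℝ) * (K.choose (p + 1) : ℝ) / y) /
        (p * (K.choose p : ℝ)) := by
    rw [hx]
    field_simp
  rw [hxi, hB']
  push_cast
  field_simp
  ring


/-- The set `R_p^r` of r-tuples of strictly positive integers summing to p. -/
noncomputable def posTuples (r p : ℕ) : Finset (Fin r → ℕ) :=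
  (Finset.Nat.antidiagonalTuple r p).filter (fun g => ∀ j, 0 < g j)

/-- Theorem 3 (uMAT DoF inner bound): solving the recursive order-p DoF relation
with repetition counts `ν_p` and terminal value `d L = 1` yields the closed form
`d 1 = K / (H_L + (C−1) + ∑_{p=2}^{L−1} ν_p/(p·binom(K,p)))`, with K = L·C. -/
theorem umat_dof_closed_form (L C : ℕ) (hL : 2 ≤ L) (hC : 1 ≤ C)
    (K : ℕ) (hK : K = L * C)
    (ν : ℕ → ℕ)
    (hν : ∀ p, 2 ≤ p → p ≤ L - 1 →
      ν p = ∑ r ∈ Finset.Icc 2 (min p C), C.choose r *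
        ∑ g ∈ posTuples r p, ∏ j, L.choose (g j))
    (d : ℕ → ℝ)
    (hdL : d L = 1)
    (hrec : ∀ p, 2 ≤ p → p ≤ L - 1 →
      d p = (((K : ℝ) - p + 1) * (K.choose p : ℝ)) /
        (((K.choose p : ℝ) + (ν p : ℝ)) + (p : ℝ) * (K.choose (p + 1) : ℝ) / d (p + 1)))
    (hd1 : d 1 = ((K : ℝ) * (K.choose 1 : ℝ)) /
      ((K.choose 1 : ℝ) + (K.choose 2 : ℝ) / d 2)) :
    (∀ p, 1 ≤ p → p ≤ L → 0 < d p) ∧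
    d 1 = (K : ℝ) /
      ((∑ p ∈ Finset.Icc 1 L, (1 : ℝ) / p) + ((C : ℝ) - 1) +
        ∑ p ∈ Finset.Icc 2 (L - 1), (ν p : ℝ) / ((p : ℝ) * (K.choose p : ℝ))) := by
  have hLK : L ≤ K := hK ▸ Nat.le_mul_of_pos_right L hC
  have hL0 : (0 : ℝ) < L := by exact_mod_cast (by omega : 0 < L)
  have key : ∀ p, p ≤ L → 2 ≤ p → 0 < d p ∧ ((K : ℝ) - p + 1) / (p * d p) =
      (∑ q ∈ Finset.Icc p L, (1 : ℝ) / q) + ((C : ℝ) - 1) +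
        ∑ q ∈ Finset.Icc p (L - 1), (ν q : ℝ) / ((q : ℝ) * (K.choose q : ℝ)) := by
    intro p hpL
    induction hpL using Nat.decreasingInduction with
    | self =>
      intro _
      refine ⟨by simp [hdL], ?_⟩
      rw [Finset.Icc_self, Finset.sum_singleton, Finset.Icc_eq_empty (by omega),
        Finset.sum_empty, hdL, hK]
      push_cast
      field_simp
      ring
    | of_succ p hp ih =>
      intro h2
      obtain ⟨hpos, heq⟩ := ih (by omega)
      obtain ⟨hx, hstep⟩ := dof_step (by omega) (by omega) (Nat.cast_nonneg (ν p)) hpos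
        (hrec p h2 (by omega))
      refine ⟨hx, ?_⟩
      rw [hstep, heq, sum_Icc_eq_add_sum_Icc_succ _ (by omega : p ≤ L),
        sum_Icc_eq_add_sum_Icc_succ _ (by omega : p ≤ L - 1)]
      ring
  obtain ⟨h2pos, h2eq⟩ := key 2 hL le_rfl
  obtain ⟨h1pos, h1eq⟩ := dof_step (K := K) (p := 1) (n := 0) le_rfl (by omega) le_rfl h2pos
    (by simpa using hd1)
  have hK0 : (0 : ℝ) < K := by exact_mod_cast (by omega : 0 < K)
  refine ⟨fun p hp hpL => ?_, ?_⟩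
  · rcases hp.eq_or_lt with rfl | h
    · exact h1pos
    · exact (key p hpL h).1
  · have hfrac : (K : ℝ) / d 1 = (∑ p ∈ Finset.Icc 1 L, (1 : ℝ) / p) + ((C : ℝ) - 1) +
        ∑ p ∈ Finset.Icc 2 (L - 1), (ν p : ℝ) / ((p : ℝ) * (K.choose p : ℝ)) := by
      rw [sum_Icc_eq_add_sum_Icc_succ _ (by omega : 1 ≤ L)]
      rw [h2eq] at h1eq
      simp only [Nat.cast_one, sub_add_cancel, one_mul, zero_div, add_zero] at h1eq
      rw [h1eq]
      push_cast
      ring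
    rw [← hfrac]
    field_simp
end

section
/- For every integer L ≥ 1, κ_L = ∑_{p=2}^{L−1} (1/p) · ∏_{j=0}^{p−1} (L−j)/(2L−j) satisfies κ_L ≤ ∑_{p=2}^{L−1} (1/p)·(1/2)^p ≤ log 2 − 1/2. -/
theorem prod_sub_div_two_mul_sub_le {L p : ℕ} (h : p ≤ L) :
    ∏ j ∈ Finset.range p, ((L : ℝ) - j) / (2 * (L : ℝ) - j) ≤ (1 / 2) ^ p := by
  have hlt : ∀ j ∈ Finset.range p, (j : ℝ) < L := fun j hj => by
    exact_mod_cast (Finset.mem_range.mp hj).trans_le h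
  calc ∏ j ∈ Finset.range p, ((L : ℝ) - j) / (2 * (L : ℝ) - j)
      ≤ ∏ _j ∈ Finset.range p, (1 / 2 : ℝ) := by
        refine Finset.prod_le_prod (fun j hj => ?_) (fun j hj => ?_)
        · have := hlt j hj
          have hj0 : (0 : ℝ) ≤ j := j.cast_nonneg
          exact div_nonneg (by linarith) (by linarith)
        · have := hlt j hj
          have hj0 : (0 : ℝ) ≤ j := j.cast_nonneg
          rw [div_le_div_iff₀ (by linarith) two_pos]
          linarith
    _ = (1 / 2) ^ p := by simp

theorem sum_Icc_two_add_half (n : ℕ) :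
    ∑ p ∈ Finset.Icc 2 (n + 1), (1 / (p : ℝ)) * (1 / 2) ^ p + 1 / 2 =
      ∑ i ∈ Finset.range (n + 1), (1 / 2 : ℝ) ^ (i + 1) / (i + 1) := by
  induction n with
  | zero => simp
  | succ n ih =>
    rw [Finset.sum_Icc_succ_top (by lia), Finset.sum_range_succ, ← ih]
    push_cast
    ring

theorem sum_Icc_two_le_log_two_sub_half (n : ℕ) :
    ∑ p ∈ Finset.Icc 2 n, (1 / (p : ℝ)) * (1 / 2) ^ p ≤ Real.log 2 - 1 / 2 := by
  have hs : HasSum (fun i : ℕ => (1 / 2 : ℝ) ^ (i + 1) / (i + 1)) (Real.log 2) := by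
    have h := Real.hasSum_pow_div_log_of_abs_lt_one (x := 1 / 2) (by norm_num [abs_of_pos])
    rwa [← Real.log_inv, show (1 - 1 / 2 : ℝ)⁻¹ = 2 by norm_num] at h
  have hle := sum_le_hasSum (Finset.range (n + 1)) (fun i _ => by positivity) hs
  rw [← sum_Icc_two_add_half] at hle
  have hmono : ∑ p ∈ Finset.Icc 2 n, (1 / (p : ℝ)) * (1 / 2) ^ p ≤
      ∑ p ∈ Finset.Icc 2 (n + 1), (1 / (p : ℝ)) * (1 / 2) ^ p :=
    Finset.sum_le_sum_of_subset_of_nonneg (Finset.Icc_subset_Icc_right n.le_succ)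
      fun _ _ _ => by positivity
  linarith

/-- Key estimate in Corollary 1: `κ_L ≤ ∑_{p=2}^{L−1} (1/p)(1/2)^p ≤ log 2 − 1/2`. -/
theorem kappa_upper_bound (L : ℕ) (hL : 1 ≤ L) (κ : ℝ)
    (hκ : κ = ∑ p ∈ Finset.Icc 2 (L - 1), (1 / (p : ℝ)) *
      ∏ j ∈ Finset.range p, ((L : ℝ) - j) / (2 * (L : ℝ) - j)) :
    κ ≤ ∑ p ∈ Finset.Icc 2 (L - 1), (1 / (p : ℝ)) * (1 / 2) ^ p ∧
    ∑ p ∈ Finset.Icc 2 (L - 1), (1 / (p : ℝ)) * (1 / 2) ^ p ≤ Real.log 2 - 1 / 2 := by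
  refine ⟨hκ.trans_le (Finset.sum_le_sum fun p hp => ?_), sum_Icc_two_le_log_two_sub_half _⟩
  have := (Finset.mem_Icc.mp hp).2
  exact mul_le_mul_of_nonneg_left (prod_sub_div_two_mul_sub_le (by lia)) (by positivity)
end

section
/- For every integer L ≥ 2, with H_L = ∑_{p=1}^{L} 1/p and κ_L = ∑_{p=2}^{L−1} (1/p) · ∏_{j=0}^{p−1} (L−j)/(2L−j), one has H_L − 1/(2L) − κ_L > 0. -/
theorem prod_sub_div_two_mul_sub_le_one {L p : ℕ} (hp : p ≤ L) :
    ∏ j ∈ Finset.range p, ((L : ℝ) - j) / (2 * (L : ℝ) - j) ≤ 1 := by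
  have hlt : ∀ j ∈ Finset.range p, (j : ℝ) < L := fun j hj => by
    exact_mod_cast (Finset.mem_range.mp hj).trans_le hp
  refine Finset.prod_le_one (fun j hj => ?_) (fun j hj => ?_)
  · have := hlt j hj
    exact div_nonneg (by linarith) (by linarith [(Nat.cast_nonneg L : (0 : ℝ) ≤ L)])
  · have := hlt j hj
    have hL : (0 : ℝ) ≤ L := Nat.cast_nonneg L
    rw [div_le_one (by linarith)]
    linarith

/-- Positivity of the uMAT denominator: for every L ≥ 2, `H_L − 1/(2L) − κ_L > 0`. -/
theorem umat_denominator_pos (L : ℕ) (hL : 2 ≤ L)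
    (H κ : ℝ)
    (hH : H = ∑ p ∈ Finset.Icc 1 L, (1 : ℝ) / p)
    (hκ : κ = ∑ p ∈ Finset.Icc 2 (L - 1), (1 / (p : ℝ)) *
      ∏ j ∈ Finset.range p, ((L : ℝ) - j) / (2 * (L : ℝ) - j)) :
    0 < H - 1 / (2 * (L : ℝ)) - κ := by
  have hκ_le : κ ≤ ∑ p ∈ Finset.Icc 2 L, (1 : ℝ) / p := by
    rw [hκ]
    calc _ ≤ ∑ p ∈ Finset.Icc 2 (L - 1), (1 : ℝ) / p := by
          refine Finset.sum_le_sum fun p hp => mul_le_of_le_one_right (by positivity) ?_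
          exact prod_sub_div_two_mul_sub_le_one (by have := Finset.mem_Icc.mp hp; omega)
      _ ≤ _ := Finset.sum_le_sum_of_subset_of_nonneg
          (Finset.Icc_subset_Icc_right (Nat.sub_le L 1)) fun p _ _ => by positivity
  have hH_eq : H = 1 + ∑ p ∈ Finset.Icc 2 L, (1 : ℝ) / p := by
    rw [hH, ← Finset.insert_Icc_add_one_left_eq_Icc (by omega : 1 ≤ L),
      Finset.sum_insert (by simp)]
    norm_num
  have hL' : (2 : ℝ) ≤ L := by exact_mod_cast hL
  have hhalf : 1 / (2 * (L : ℝ)) < 1 := by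
    rw [div_lt_one (by linarith)]
    linarith
  linarith
end

section
/- For every integer L ≥ 2, with H_L = ∑_{p=1}^{L} 1/p and κ_L = ∑_{p=2}^{L−1} (1/p) · ∏_{j=0}^{p−1} (L−j)/(2L−j), one has L/(H_L − 1/(2L) − κ_L) > L/H_L. -/
/-- Each factor `(L − j)/(2L − j)` with `j < p ≤ L` lies in `[0, 1]`. -/
lemma factor_mem_unitInterval {L p j : ℕ} (hp : p ≤ L) (hj : j ∈ Finset.range p) :
    0 ≤ ((L : ℝ) - j) / (2 * (L : ℝ) - j) ∧ ((L : ℝ) - j) / (2 * (L : ℝ) - j) ≤ 1 := by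
  have hjL : (j : ℝ) < L := by
    exact_mod_cast (Finset.mem_range.mp hj).trans_le hp
  have hj0 : (0 : ℝ) ≤ j := j.cast_nonneg
  have hden : 0 < 2 * (L : ℝ) - j := by linarith
  exact ⟨div_nonneg (by linarith) hden.le, (div_le_one hden).mpr (by linarith)⟩

/-- For every L ≥ 2 the uMAT sum-DoF strictly exceeds the MAT (time-sharing) sum-DoF:
`L/(H_L − 1/(2L) − κ_L) > L/H_L`. -/
theorem umat_gt_mat (L : ℕ) (hL : 2 ≤ L)
    (H κ : ℝ)
    (hH : H = ∑ p ∈ Finset.Icc 1 L, (1 : ℝ) / p)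
    (hκ : κ = ∑ p ∈ Finset.Icc 2 (L - 1), (1 / (p : ℝ)) *
      ∏ j ∈ Finset.range p, ((L : ℝ) - j) / (2 * (L : ℝ) - j)) :
    (L : ℝ) / H < (L : ℝ) / (H - 1 / (2 * (L : ℝ)) - κ) := by
  have hL2 : (2 : ℝ) ≤ L := by exact_mod_cast hL
  have hp_le {p : ℕ} (hp : p ∈ Finset.Icc 2 (L - 1)) : p ≤ L := by
    have := Finset.mem_Icc.mp hp
    omega
  have hκ_nonneg : 0 ≤ κ := by
    rw [hκ]
    exact Finset.sum_nonneg fun p hp ↦ mul_nonneg (by positivity)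
      (Finset.prod_nonneg fun j hj ↦ (factor_mem_unitInterval (hp_le hp) hj).1)
  have hκ_le : κ ≤ ∑ p ∈ Finset.Icc 2 (L - 1), (1 : ℝ) / p := by
    rw [hκ]
    exact Finset.sum_le_sum fun p hp ↦ mul_le_of_le_one_right (by positivity)
      (Finset.prod_le_one (fun j hj ↦ (factor_mem_unitInterval (hp_le hp) hj).1)
        fun j hj ↦ (factor_mem_unitInterval (hp_le hp) hj).2)
  have hH_ge : 1 + ∑ p ∈ Finset.Icc 2 (L - 1), (1 : ℝ) / p ≤ H := by
    have hsub : Finset.Icc 2 (L - 1) ⊆ (Finset.Icc 1 L).erase 1 := by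
      intro p hp
      simp only [Finset.mem_erase, Finset.mem_Icc] at hp ⊢
      omega
    have hsum := Finset.add_sum_erase (Finset.Icc 1 L) (fun p : ℕ ↦ (1 : ℝ) / p)
      (Finset.mem_Icc.mpr ⟨le_rfl, by omega⟩ : 1 ∈ Finset.Icc 1 L)
    rw [hH, ← hsum, Nat.cast_one, div_one]
    gcongr
  have hpos : 0 < 1 / (2 * (L : ℝ)) := by positivity
  have hlt : 1 / (2 * (L : ℝ)) < 1 := by
    rw [div_lt_one (by linarith)]
    linarith
  exact div_lt_div_of_pos_left (by linarith) (by linarith) (by linarith)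
end

section
/- Let K ≥ L ≥ 2 be integers and let R_1, R_2, …, R_{L−1} be strictly positive real numbers. Define real numbers d_L, …, d_1 by d_L = 1, d_p = ((K−p+1)·binom(K,p)) / (R_p + p·binom(K,p+1)/d_{p+1}) for 2 ≤ p ≤ L−1, and d_1 = K² / (R_1 + binom(K,2)/d_2). Then every d_p is strictly positive and d_1 = K² / ( R_1 + ∑_{p=2}^{L−1} R_p·(p−1)! / ∏_{j=1}^{p−1}(K−j) + (L−1)·binom(K,L)·(L−2)! / ∏_{j=1}^{L−2}(K−j) ), where an empty product equals 1. -/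
/-- The recursion for `d` has positive values when the round counts are positive. -/
theorem umat_recursion_pos {K L : ℕ} (hKL : L ≤ K) {R d : ℕ → ℝ}
    (hR : ∀ p, 1 ≤ p → p ≤ L - 1 → 0 < R p) (hdL : d L = 1)
    (hrec : ∀ p, 2 ≤ p → p ≤ L - 1 →
      d p = (((K : ℝ) - p + 1) * (K.choose p : ℝ)) /
        (R p + (p : ℝ) * (K.choose (p + 1) : ℝ) / d (p + 1)))
    {p : ℕ} (hp : 2 ≤ p) (hpL : p ≤ L) : 0 < d p := by
  induction hpL using Nat.decreasingInduction with
  | self => simp [hdL]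
  | of_succ p hlt ih =>
    have hnext := ih (by omega)
    have hRp := hR p (by omega) (by omega)
    have hchoose : (0 : ℝ) < K.choose p := by
      exact_mod_cast Nat.choose_pos (by omega : p ≤ K)
    have hpK : (p : ℝ) ≤ K := by exact_mod_cast (by omega : p ≤ K)
    have hfactor : (0 : ℝ) < (K : ℝ) - p + 1 := by linarith
    rw [hrec p hp (by omega)]
    positivity

/-- Partial unfolding of the recursion through the first `m` phases after phase one. -/
theorem umat_recursion_partial_unfold {K L : ℕ} (hKL : L ≤ K) {R d : ℕ → ℝ}
    (hrec : ∀ p, 2 ≤ p → p ≤ L - 1 →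
      d p = (((K : ℝ) - p + 1) * (K.choose p : ℝ)) /
        (R p + (p : ℝ) * (K.choose (p + 1) : ℝ) / d (p + 1)))
    (m : ℕ) (hm : m + 2 ≤ L) :
    (K.choose 2 : ℝ) / d 2 =
      (∑ p ∈ Finset.Icc 2 (m + 1),
        R p * ((p - 1).factorial : ℝ) / ∏ j ∈ Finset.Icc 1 (p - 1), ((K : ℝ) - j)) +
      ((m : ℝ) + 1) * (K.choose (m + 2) : ℝ) / d (m + 2) * (m.factorial : ℝ) /
        ∏ j ∈ Finset.Icc 1 m, ((K : ℝ) - j) := by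
  induction m with
  | zero => simp
  | succ m ih =>
    have hchoose : (K.choose (m + 2) : ℝ) ≠ 0 := by
      exact_mod_cast (Nat.choose_pos (by omega : m + 2 ≤ K)).ne'
    have hmK : (m : ℝ) + 3 ≤ K := by exact_mod_cast (by omega : m + 3 ≤ K)
    have hfactor : (K : ℝ) - (m + 1) ≠ 0 := by linarith
    have hprod : ∏ j ∈ Finset.Icc 1 m, ((K : ℝ) - j) ≠ 0 := by
      refine Finset.prod_ne_zero_iff.mpr fun j hj => ?_
      have hjm : (j : ℝ) ≤ m := by exact_mod_cast (Finset.mem_Icc.mp hj).2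
      linarith
    have hstep : (K.choose (m + 2) : ℝ) / d (m + 2) =
        (R (m + 2) + ((m : ℝ) + 2) * (K.choose (m + 3) : ℝ) / d (m + 3)) /
          ((K : ℝ) - (m + 1)) := by
      have hcoef : (K : ℝ) - ((m + 2 : ℕ) : ℝ) + 1 = (K : ℝ) - (m + 1) := by
        push_cast; ring
      rw [hrec (m + 2) (by omega) (by omega), hcoef, div_div_eq_mul_div,
        mul_comm ((K : ℝ) - (m + 1)), mul_div_mul_left _ _ hchoose]
      push_cast
      rfl
    rw [ih (by omega), mul_div_assoc ((m : ℝ) + 1), hstep,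
      Finset.sum_Icc_succ_top (by omega : 2 ≤ m + 1 + 1),
      show m + 1 + 1 - 1 = m + 1 from rfl,
      Finset.prod_Icc_succ_top (by omega : 1 ≤ m + 1), Nat.factorial_succ]
    push_cast
    field_simp
    ring


/-- Unfolded form of the uMAT/MAT recursion (proof of Corollary 2): with symbolic
positive per-phase round counts `R p` and terminal value `d L = 1`, the recursion
unfolds into a single rational expression for `d 1`. An empty product equals 1. -/
theorem umat_recursion_unfolded (K L : ℕ) (hL : 2 ≤ L) (hKL : L ≤ K)
    (R : ℕ → ℝ) (hR : ∀ p, 1 ≤ p → p ≤ L - 1 → 0 < R p)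
    (d : ℕ → ℝ)
    (hdL : d L = 1)
    (hrec : ∀ p, 2 ≤ p → p ≤ L - 1 →
      d p = (((K : ℝ) - p + 1) * (K.choose p : ℝ)) /
        (R p + (p : ℝ) * (K.choose (p + 1) : ℝ) / d (p + 1)))
    (hd1 : d 1 = (K : ℝ) ^ 2 / (R 1 + (K.choose 2 : ℝ) / d 2)) :
    (∀ p, 1 ≤ p → p ≤ L → 0 < d p) ∧
    d 1 = (K : ℝ) ^ 2 /
      (R 1 +
        (∑ p ∈ Finset.Icc 2 (L - 1),
          R p * ((p - 1).factorial : ℝ) / ∏ j ∈ Finset.Icc 1 (p - 1), ((K : ℝ) - j)) +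
        ((L : ℝ) - 1) * (K.choose L : ℝ) * ((L - 2).factorial : ℝ) /
          ∏ j ∈ Finset.Icc 1 (L - 2), ((K : ℝ) - j)) := by
  have hpos : ∀ p, 2 ≤ p → p ≤ L → 0 < d p := fun p hp hpL =>
    umat_recursion_pos hKL hR hdL hrec hp hpL
  refine ⟨fun p hp hpL => ?_, ?_⟩
  · rcases hp.eq_or_lt with rfl | hp
    · have hd2 := hpos 2 le_rfl hL
      have hR1 := hR 1 le_rfl (by omega)
      have hK : (0 : ℝ) < K := by exact_mod_cast (by omega : 0 < K)
      rw [hd1]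
      positivity
    · exact hpos p hp hpL
  · obtain ⟨m, rfl⟩ := Nat.exists_eq_add_of_le' hL
    have hcast : ((m + 2 : ℕ) : ℝ) - 1 = m + 1 := by push_cast; ring
    rw [hd1, umat_recursion_partial_unfold hKL hrec m le_rfl, hdL, div_one, hcast,
      ← add_assoc]
    rfl
end
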